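/- Consider a moving-target closed-loop solution (d, φ, v1, v2) satisfying the gain conditions, and suppose there exists s* ∈ (0, 1] such that for all t ≥ t0: d(t) > r_d/2 and sin(φ(t)) ≥ s*. Let e(t) = (d(t) − r_d)/r_d and z(t) = e'(t) + (c2/c1)·sat(e(t)). Then limsup_{t→∞} |z(t)| ≤ (ω_c·(ω_c + 2·ω_o) + ā_o/r_d + (c2/c1)·(v + v̄_o))/(c1·ω_c·s*). (Step 2 of the proof of Proposition 2: uniform ultimate bound on the sliding variable z.) -/

import Mathlib

open Real Filter

/-- Saturation function: `sat z = z` if `|z| < 1`, `sign z` otherwise. -/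
noncomputable def sat (z : ℝ) : ℝ := if |z| < 1 then z else Real.sign z

section

open Set Topology

lemma sat_eq_max_min (z : ℝ) : sat z = max (-1) (min 1 z) := by
  unfold sat
  split_ifs with h
  · rw [abs_lt] at h
    rw [min_eq_right h.2.le, max_eq_right h.1.le]
  · rcases le_abs'.mp (not_lt.mp h) with h' | h'
    · rw [Real.sign_of_neg (by linarith), min_eq_right (by linarith), max_eq_left h']
    · rw [Real.sign_of_pos (by linarith), min_eq_left h', max_eq_right (by norm_num)]

lemma continuous_sat : Continuous sat := by
  have : sat = fun z => max (-1) (min 1 z) := funext sat_eq_max_min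
  rw [this]
  fun_prop

lemma sat_mono : Monotone sat := fun a b h => by
  simp only [sat_eq_max_min]
  gcongr

lemma sat_le_self {z : ℝ} (hz : -1 ≤ z) : sat z ≤ z := by
  rw [sat_eq_max_min]
  exact max_le hz (min_le_right _ _)

lemma sat_of_mem {z : ℝ} (h1 : -1 ≤ z) (h2 : z ≤ 1) : sat z = z := by
  rw [sat_eq_max_min, min_eq_right h2, max_eq_right h1]

lemma sat_sub_le (a b : ℝ) : sat b - sat a ≤ max 0 (b - a) := by
  rcases le_total b a with h | h
  · exact (sub_nonpos.mpr (sat_mono h)).trans (le_max_left _ _)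
  · refine le_trans ?_ (le_max_right _ _)
    simp only [sat_eq_max_min]
    rcases max_cases (-1 : ℝ) (min 1 b) with h1 | h1 <;>
    rcases max_cases (-1 : ℝ) (min 1 a) with h2 | h2 <;>
    rcases min_cases (1 : ℝ) b with h3 | h3 <;>
    rcases min_cases (1 : ℝ) a with h4 | h4 <;> linarith

/-- The upper right Dini derivative of `f` at `t` is at most `m`. -/
def UpperSlopeLE (f : ℝ → ℝ) (t m : ℝ) : Prop :=
  ∀ r, m < r → ∀ᶠ z in 𝓝[>] t, slope f t z < r

lemma UpperSlopeLE.mono {f : ℝ → ℝ} {t m m' : ℝ} (h : UpperSlopeLE f t m) (hm : m ≤ m') :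
    UpperSlopeLE f t m' := fun r hr => h r (hm.trans_lt hr)

lemma HasDerivAt.tendsto_slope_right {f : ℝ → ℝ} {t m : ℝ} (h : HasDerivAt f m t) :
    Tendsto (slope f t) (𝓝[>] t) (𝓝 m) :=
  (hasDerivAt_iff_tendsto_slope.mp h).mono_left
    (nhdsWithin_mono _ fun _ hz => ne_of_gt hz)

lemma HasDerivAt.upperSlopeLE {f : ℝ → ℝ} {t m : ℝ} (h : HasDerivAt f m t) :
    UpperSlopeLE f t m := fun _ hr => h.tendsto_slope_right.eventually_lt_const hr

lemma UpperSlopeLE.add {f g : ℝ → ℝ} {t m n : ℝ} (hf : UpperSlopeLE f t m)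
    (hg : UpperSlopeLE g t n) : UpperSlopeLE (fun s => f s + g s) t (m + n) := by
  intro r hr
  filter_upwards [hf (m + (r - (m + n)) / 2) (by linarith),
    hg (n + (r - (m + n)) / 2) (by linarith)] with z h1 h2
  have : slope (fun s => f s + g s) t z = slope f t z + slope g t z := by
    simp only [slope_def_field]; ring
  rw [this]; linarith

lemma UpperSlopeLE.const_mul {f : ℝ → ℝ} {t m k : ℝ} (hf : UpperSlopeLE f t m) (hk : 0 < k) :
    UpperSlopeLE (fun s => k * f s) t (k * m) := by
  intro r hr
  filter_upwards [hf (r / k) (by rwa [lt_div_iff₀' hk])] with z h1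
  have : slope (fun s => k * f s) t z = k * slope f t z := by
    simp only [slope_def_field]; ring
  rwa [this, ← lt_div_iff₀' hk]

lemma UpperSlopeLE.max {f g : ℝ → ℝ} {t m : ℝ} (hf : ContinuousAt f t) (hg : ContinuousAt g t)
    (h1 : g t ≤ f t → UpperSlopeLE f t m) (h2 : f t ≤ g t → UpperSlopeLE g t m) :
    UpperSlopeLE (fun s => max (f s) (g s)) t m := by
  intro r hr
  rcases lt_trichotomy (f t) (g t) with h | h | h
  · have hev : ∀ᶠ z in 𝓝[>] t, f z < g z :=
      nhdsWithin_le_nhds (hf.eventually_lt hg h)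
    filter_upwards [hev, h2 h.le r hr] with z hz hz'
    simpa only [slope_def_field, max_eq_right hz.le, max_eq_right h.le] using hz'
  · filter_upwards [h1 h.ge r hr, h2 h.le r hr, self_mem_nhdsWithin] with z hz hz' hzt
    have hp : 0 < z - t := sub_pos.mpr hzt
    simp only [slope_def_field, h, max_self] at hz hz' ⊢
    rw [div_lt_iff₀ hp] at hz hz' ⊢
    rcases max_choice (f z) (g z) with h' | h' <;> rw [h'] <;> assumption
  · have hev : ∀ᶠ z in 𝓝[>] t, g z < f z :=
      nhdsWithin_le_nhds (hg.eventually_lt hf h)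
    filter_upwards [hev, h1 h.le r hr] with z hz hz'
    simpa only [slope_def_field, max_eq_left hz.le, max_eq_left h.le] using hz'

lemma HasDerivAt.upperSlopeLE_sat {e : ℝ → ℝ} {t m : ℝ} (h : HasDerivAt e m t) :
    UpperSlopeLE (fun s => sat (e s)) t (max 0 m) := by
  intro r hr
  have hr' := max_lt_iff.mp hr
  filter_upwards [h.upperSlopeLE r hr'.2, self_mem_nhdsWithin] with z hz hzt
  have hp : 0 < z - t := sub_pos.mpr hzt
  simp only [slope_def_field] at hz ⊢
  rw [div_lt_iff₀ hp] at hz ⊢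
  exact (sat_sub_le _ _).trans_lt (max_lt (mul_pos hr'.1 hp) hz)

lemma HasDerivAt.upperSlopeLE_neg_sat {e : ℝ → ℝ} {t m : ℝ} (h : HasDerivAt e m t) :
    UpperSlopeLE (fun s => -sat (e s)) t (max 0 (-m)) := by
  intro r hr
  have hr' := max_lt_iff.mp hr
  filter_upwards [h.neg.upperSlopeLE r hr'.2, self_mem_nhdsWithin] with z hz hzt
  have hp : 0 < z - t := sub_pos.mpr hzt
  simp only [slope_def_field, Pi.neg_apply] at hz ⊢
  rw [div_lt_iff₀ hp] at hz ⊢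
  have := (sat_sub_le (e z) (e t)).trans_lt
    (max_lt (mul_pos hr'.1 hp) (show e t - e z < r * (z - t) by linarith))
  linarith

/-- A function that decreases at a uniform rate whenever it is at least `b` is eventually at
most `b`. -/
lemma eventually_le_of_upperSlopeLE {f : ℝ → ℝ} {T b δ : ℝ} (hδ : 0 < δ)
    (hf : ContinuousOn f (Ici T)) (h : ∀ t ≥ T, b ≤ f t → UpperSlopeLE f t (-δ)) :
    ∀ᶠ t in atTop, f t ≤ b := by
  have key : ∀ a ≥ T, ∀ t ≥ a, (∀ x ∈ Ico a t, b ≤ f x) → f t ≤ f a - δ * (t - a) := by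
    intro a ha t hat hx
    refine image_le_of_liminf_slope_right_le_deriv_boundary (a := a) (b := t)
      (B := fun s => f a - δ * (s - a)) (B' := fun _ => -δ)
      (hf.mono fun s hs => ha.le.trans hs.1) (by simp) (by fun_prop) ?_ ?_ ⟨hat, le_rfl⟩
    · intro x _
      have := (((hasDerivAt_id x).sub_const a).const_mul δ).const_sub (f a)
      simpa using this.hasDerivWithinAt
    · intro x hx' r hr
      exact (h x (ha.le.trans hx'.1) (hx x hx') r hr).frequently
  obtain ⟨a, haT, hab⟩ : ∃ a ≥ T, f a ≤ b := by
    by_contra! hcon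
    have hpos : 0 < f T - b := sub_pos.mpr (hcon T le_rfl)
    have h1 := key T le_rfl (T + (f T - b) / δ) (by simp [div_nonneg hpos.le hδ.le])
      fun x hx => (hcon x hx.1).le
    have h2 := hcon (T + (f T - b) / δ) (by simp [div_nonneg hpos.le hδ.le])
    rw [add_sub_cancel_left, mul_div_cancel₀ _ hδ.ne'] at h1
    linarith
  filter_upwards [eventually_ge_atTop a] with t hat
  by_contra! hcon
  let s := {x | f x ≤ b} ∩ Icc a t
  have hs : s.Nonempty := ⟨a, hab, le_rfl, hat⟩
  have hcl : IsClosed s := by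
    have hc : ContinuousOn f (Icc a t) := hf.mono fun x hx => haT.le.trans hx.1
    have := hc.preimage_isClosed_of_isClosed isClosed_Icc (isClosed_Iic (a := b))
    rwa [inter_comm] at this
  have hbd : BddAbove s := ⟨t, fun x hx => hx.2.2⟩
  have hmem := hcl.csSup_mem hs hbd
  set τ := sSup s
  have hgt : ∀ x, τ < x → x ≤ t → b < f x := by
    intro x hx hxt
    by_contra! hxb
    exact absurd (le_csSup hbd (show x ∈ s from ⟨hxb, hmem.2.1.trans hx.le, hxt⟩)) (not_le.mpr hx)
  have hτt : τ < t := lt_of_le_of_ne hmem.2.2 fun hEq => by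
    have := hmem.1
    simp only [mem_ofPred_eq, hEq] at this
    linarith
  have hτb : b ≤ f τ := by
    have hc : Tendsto f (𝓝[>] τ) (𝓝 (f τ)) :=
      (hf τ (haT.le.trans hmem.2.1)).mono_left
        (nhdsWithin_mono _ fun x hx => (haT.le.trans hmem.2.1).trans (le_of_lt hx))
    refine ge_of_tendsto hc ?_
    filter_upwards [Ioc_mem_nhdsGT hτt] with x hx
    exact (hgt x hx.1 hx.2).le
  have h1 := key τ (haT.le.trans hmem.2.1) t hτt.le fun x hx => by
    rcases hx.1.eq_or_lt with h' | h'
    · rwa [← h']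
    · exact (hgt x h' hx.2.le).le
  have h2 : f τ ≤ b := hmem.1
  nlinarith [sub_pos.mpr hτt]

lemma cos_barrier_poly_aux {c o : ℝ} (ho : 0 < o) (hc : 3 < c) (hoc : o * (c + 5) < c - 3) (ho2 : o < 1
    / 2) :
    2 * (c - 1 - (c + 1) * o) * c * (1 + (c + 3) * o) + 2 * (c - 1 - (c + 1) * o) ^ 2 * (1571 / 1000
     + 6 / 5 * o) < c ^ 3 := by
  obtain ⟨y, rfl⟩ : ∃ y, c = 3 + y := ⟨c - 3, by ring⟩
  have hy : 0 < y := by linarith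
  nlinarith [mul_pos hy ho, mul_pos (mul_pos hy hy) (sub_pos.mpr ho2), mul_pos (mul_pos hy hy) hy,
    mul_pos (mul_pos (mul_pos hy hy) hy) (sub_pos.mpr ho2), mul_pos (sub_pos.mpr ho2) ho, mul_pos
    (mul_pos hy hy) ho, mul_pos hy (sub_pos.mpr hoc), mul_nonneg (mul_pos hy hy).le (sq_nonneg
    (o - 1/2)), mul_nonneg (mul_pos (mul_pos hy hy) hy).le (sq_nonneg (o - 1/2)), mul_nonneg (mul_pos hy
    hy).le (sq_nonneg (o - 1/3)), mul_nonneg hy.le (sq_nonneg (o - 1/2)), mul_nonneg hy.le (sq_nonneg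
    o)]

lemma cos_barrier_poly {c o k : ℝ} (ho : 0 < o) (ho2 : o < 1 / 2) (hc : 3 < c)
    (hoc : o * (c + 5) < c - 3) (hk : 0 < k) (h1 : c * k < c - 1 - (c + 1) * o) :
    1 + (c + 3) * o + k * (1571 / 1000 + 6 / 5 * o) < c * (1 / (2 * k)) := by
  have hc0 : 0 < c := by linarith
  have key := cos_barrier_poly_aux ho hc hoc ho2
  have hck : 0 < c * k := mul_pos hc0 hk
  have h2 : 2 * (c * k) * c * (1 + (c + 3) * o) + 2 * (c * k) ^ 2 * (1571 / 1000 + 6 / 5 * o)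
      ≤ 2 * (c - 1 - (c + 1) * o) * c * (1 + (c + 3) * o)
        + 2 * (c - 1 - (c + 1) * o) ^ 2 * (1571 / 1000 + 6 / 5 * o) := by
    gcongr
  rw [mul_one_div, lt_div_iff₀ (by linarith)]
  have h3 : c ^ 2 * ((1 + (c + 3) * o + k * (1571 / 1000 + 6 / 5 * o)) * (2 * k)) < c ^ 2 * c := by
    nlinarith
  exact lt_of_mul_lt_mul_left h3 (by positivity)

lemma lower_error_bound_le {c o : ℝ} (ho : 0 < o) (hoc : o * (c + 5) < c - 3) (ho2 : o < 1 / 2) (hc : 3 < c) :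
    14 / 100 + 16 / 100 * o + (88 / 100 + 6 / 5 * o) / c ≤ 435 / 1000 - 15 / 100 * o := by
  rw [← le_sub_iff_add_le', div_le_iff₀ (by linarith)]
  nlinarith

lemma sin_mul_sin_add_le {S C o k : ℝ} (hS : 65 / 100 ≤ S) (hSC : S ^ 2 + C ^ 2 ≤ 1) (hC : 0 ≤ C)
    (ho : 0 < o) (ho2 : o < 1 / 2) (hk : k ≤ 1 - o) :
    S * (S + o) ≤ (565 / 1000 + 15 / 100 * o) * (1 + 2 * o + S - k * (C + o)) := by
  have : k * (C + o) ≤ (1 - o) * (C + o) := by gcongr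
  have hS1 : S ≤ 1 - C ^ 2 / 2 := by nlinarith
  nlinarith [mul_nonneg ho.le (sub_nonneg.mpr hS1), sq_nonneg (C - 2/5), mul_nonneg ho.le (sq_nonneg
    (C - 2/5)), mul_pos ho (sub_pos.mpr ho2), mul_pos ho (mul_pos ho (sub_pos.mpr ho2)), mul_nonneg
    ho.le hC]

lemma sin_sector_bound_of_le {S C o k : ℝ} (hS0 : 0 < S) (hS : S ≤ 65 / 100) (hSC : S ^ 2 + C ^ 2 ≤ 1)
    (hC : 0 ≤ C) (ho : 0 < o) (ho2 : o < 1 / 2) (hk : k ≤ 1 - o) :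
    S * (2 * S + 2 * o - 1) + k * (C + o) ≤ 1 + 2 * o := by
  have : k * (C + o) ≤ (1 - o) * (C + o) := by gcongr
  have hC1 : C ≤ 1 - S ^ 2 / 2 := by nlinarith
  have : (1 - o) * (C + o) ≤ (1 - o) * (1 - S ^ 2 / 2 + o) := by gcongr; linarith
  nlinarith [mul_nonneg hS0.le (sub_nonneg.mpr hS), mul_pos ho hS0]

lemma sin_sector_bound_of_ge {S C o k : ℝ} (hS : 65 / 100 ≤ S) (hSC : S ^ 2 + C ^ 2 ≤ 1)
    (hC : 0 ≤ C) (ho : 0 < o) (ho2 : o < 1 / 2) (hk : k ≤ 1 - o) :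
    S * (2 * S + 2 * o - 1) + k * (C + o) ≤ (1 + 2 * o) * (S / (65 / 100)) := by
  have : k * (C + o) ≤ (1 - o) * (C + o) := by gcongr
  have hC1 : 65 / 100 * S + 76 / 100 * C ≤ 10001 / 10000 := by
    nlinarith [sq_nonneg (S - 65 / 100), sq_nonneg (C - 76 / 100)]
  have hS1 : S ≤ 1 := by nlinarith
  have : (1 - o) * (C + o) ≤ (1 - o) * ((10001 / 10000 - 65 / 100 * S) / (76 / 100) + o) := by
    gcongr
    · linarith
    · linarith
  nlinarith [mul_nonneg (sub_nonneg.mpr hS) (sub_nonneg.mpr hS1),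
    mul_nonneg ho.le (sub_nonneg.mpr hS), mul_nonneg ho.le (sub_nonneg.mpr hS1)]

lemma sin_sector_bound_neg {S e o k D : ℝ} (hS0 : 0 < S) (hS1 : S ≤ 1) (he : -(1 / 2) < e) (he1 : e ≤ 1)
    (ho : 0 < o) (ho2 : o < 1 / 2) (hk : k ≤ 1) (hD : k * D ≤ 1 / 2) :
    S * (1 - (S - o) / (1 + e)) + k * (D + o) ≤ 1 + 2 * o := by
  have hko : k * o ≤ o := by nlinarith
  rcases le_total o S with h | h
  · have : (S - o) / 2 ≤ (S - o) / (1 + e) := by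
      apply div_le_div_of_nonneg_left <;> linarith
    nlinarith [mul_le_mul_of_nonneg_left this hS0.le, sq_nonneg (1 - S), mul_le_mul_of_nonneg_left
      hS1 ho.le]
  · have : -(2 * (o - S)) ≤ (S - o) / (1 + e) := by
      rw [le_div_iff₀ (by linarith)]
      nlinarith
    nlinarith [mul_le_mul_of_nonneg_left this hS0.le, sq_nonneg (o - 2 * S)]

/-- The closed loop in normalized variables: `e` is the relative radial error, velocities are
measured in units of `v`, and `ω = v / r_d`. -/
structure NormalizedLoop (ω c k o α s t₀ : ℝ) (e φ u₁ u₂ w : ℝ → ℝ) : Prop where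
  hω : 0 < ω
  ho : 0 < o
  ho2 : o < 1 / 2
  hc : 3 < c
  hk : 0 < k
  hgain : c * k < c - 1 - (c + 1) * o
  hgain' : 2 + 4 * o < c * k
  hs : 0 < s
  hα : 0 ≤ α
  de : ∀ t ≥ t₀, HasDerivAt e (ω * (cos (φ t) - u₁ t)) t
  dφ : ∀ t ≥ t₀, HasDerivAt φ
    (ω * (1 + c * (cos (φ t) - u₁ t + k * sat (e t)) - (sin (φ t) - u₂ t) / (1 + e t))) t
  du : ∀ t ≥ t₀, HasDerivAt u₁ (w t) t
  hw : ∀ t ≥ t₀, |w t| ≤ ω * α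
  hu₁ : ∀ t ≥ t₀, |u₁ t| ≤ o
  hu₂ : ∀ t ≥ t₀, |u₂ t| ≤ o
  he : ∀ t ≥ t₀, -(1 / 2) < e t
  hsin : ∀ t ≥ t₀, s ≤ sin (φ t)
  φ_pos : ∀ t ≥ t₀, 0 < φ t
  φ_lt : ∀ t ≥ t₀, φ t < π

namespace NormalizedLoop

variable {ω c k o α s t₀ : ℝ} {e φ u₁ u₂ w : ℝ → ℝ}

lemma hoc (L : NormalizedLoop ω c k o α s t₀ e φ u₁ u₂ w) : o * (c + 5) < c - 3 := by
  linarith [L.hgain, L.hgain']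

lemma k_le (L : NormalizedLoop ω c k o α s t₀ e φ u₁ u₂ w) : k ≤ 1 - o := by
  have h1 := L.hgain
  have h2 := L.hc
  have h3 := L.ho
  by_contra! h
  nlinarith

lemma continuousOn_e (L : NormalizedLoop ω c k o α s t₀ e φ u₁ u₂ w) :
    ContinuousOn e (Ici t₀) := fun t ht => (L.de t ht).continuousAt.continuousWithinAt

lemma continuousOn_φ (L : NormalizedLoop ω c k o α s t₀ e φ u₁ u₂ w) :
    ContinuousOn φ (Ici t₀) := fun t ht => (L.dφ t ht).continuousAt.continuousWithinAt

lemma continuousOn_u₁ (L : NormalizedLoop ω c k o α s t₀ e φ u₁ u₂ w) :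
    ContinuousOn u₁ (Ici t₀) := fun t ht => (L.du t ht).continuousAt.continuousWithinAt

lemma le_sin_mul (L : NormalizedLoop ω c k o α s t₀ e φ u₁ u₂ w) :
    o * (109 / 100) ≤ sin (6 / 5 * o) := by
  have h1 := L.ho
  have h2 := L.ho2
  have := Real.sin_gt_sub_cube (x := 6 / 5 * o) (by linarith)
  have h3 : o ^ 2 ≤ 1 / 4 := by nlinarith
  nlinarith

lemma cos_le_of_le (L : NormalizedLoop ω c k o α s t₀ e φ u₁ u₂ w) {t : ℝ} (ht : t₀ ≤ t)
    (h : π / 2 + 6 / 5 * o ≤ φ t) : cos (φ t) ≤ -(o * (109 / 100)) := by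
  have h1 := cos_le_cos_of_nonneg_of_le_pi (by have := L.ho; have := pi_pos; positivity)
    (L.φ_lt t ht).le h
  rw [add_comm, cos_add_pi_div_two] at h1
  linarith [L.le_sin_mul]

lemma le_cos_of_le (L : NormalizedLoop ω c k o α s t₀ e φ u₁ u₂ w) {t : ℝ} (ht : t₀ ≤ t)
    (h : φ t ≤ π / 2 - 6 / 5 * o) : o * (109 / 100) ≤ cos (φ t) := by
  have h1 := cos_le_cos_of_nonneg_of_le_pi (L.φ_pos t ht).le
    (by have := L.ho; have := pi_pos; linarith) h
  rw [cos_pi_div_two_sub] at h1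
  linarith [L.le_sin_mul]

lemma eventually_e_le (L : NormalizedLoop ω c k o α s t₀ e φ u₁ u₂ w) :
    ∀ᶠ t in atTop, e t ≤ o / (c * k + 1) + (1571 / 1000 + 6 / 5 * o) / c := by
  have hω := L.hω
  have ho := L.ho
  have ho2 := L.ho2
  have hc := L.hc
  have hc0 : 0 < c := by linarith
  have hk := L.hk
  have hck : 0 < c * k := mul_pos hc0 hk
  have hg' := L.hgain'
  set e₀ := o / (c * k + 1) with he₀
  have he₀pos : 0 < e₀ := by positivity
  have he₀eq : e₀ * (c * k + 1) = o := by rw [he₀]; field_simp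
  have he₀1 : e₀ ≤ 1 := by nlinarith
  let δ₁ := 1 + c * k * e₀ - (1 + o) / (1 + e₀)
  have hδ₁ : 0 < δ₁ := by
    have : (1 + o) / (1 + e₀) < 1 + c * k * e₀ := by
      rw [div_lt_iff₀ (by linarith)]
      nlinarith [mul_pos hck (mul_pos he₀pos he₀pos)]
    exact sub_pos.mpr this
  let δ := min (ω * δ₁) (c * (ω * (o * (9 / 100))))
  have hδ : 0 < δ := lt_min (by positivity) (by positivity)
  have hbar := eventually_le_of_upperSlopeLE (T := t₀) (b := c * e₀) (δ := δ)
    (f := fun t => max (c * e t - φ t) (c * e t - (π / 2 + 6 / 5 * o))) hδ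
    (((L.continuousOn_e.const_smul c).sub L.continuousOn_φ).sup
      ((L.continuousOn_e.const_smul c).sub continuousOn_const)) ?_
  · filter_upwards [hbar] with t ht
    have h1 := (le_max_right _ _).trans ht
    rw [← sub_le_iff_le_add', le_div_iff₀ hc0]
    linarith [pi_lt_d4]
  · intro t ht hb
    have hφ := L.φ_pos t ht
    have hu₁ := abs_le.mp (L.hu₁ t ht)
    have hu₂ := abs_le.mp (L.hu₂ t ht)
    have d1 := ((L.de t ht).const_mul c).sub (L.dφ t ht)
    have d2 := ((L.de t ht).const_mul c).sub_const (π / 2 + 6 / 5 * o)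
    refine UpperSlopeLE.max d1.continuousAt d2.continuousAt (fun h => d1.upperSlopeLE.mono ?_)
      (fun h => d2.upperSlopeLE.mono ?_)
    · rw [max_eq_left h] at hb
      have hee : e₀ ≤ e t := by
        by_contra! hlt
        nlinarith
      have hsat : e₀ ≤ sat (e t) := by
        rw [← sat_of_mem (by linarith) he₀1]
        exact sat_mono hee
      have hfrac : (sin (φ t) - u₂ t) / (1 + e t) ≤ (1 + o) / (1 + e₀) := by
        apply div_le_div₀ <;> linarith [sin_le_one (φ t)]
      have hmul : c * k * e₀ ≤ c * k * sat (e t) := by gcongr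
      have : ω * δ₁ ≤ ω * (1 + c * k * sat (e t) - (sin (φ t) - u₂ t) / (1 + e t)) := by
        apply mul_le_mul_of_nonneg_left _ hω.le
        simp only [δ₁]
        linarith
      have hmin : δ ≤ ω * δ₁ := min_le_left _ _
      linarith
    · have hcos := L.cos_le_of_le ht (by linarith)
      have : c * (ω * (o * (9 / 100))) ≤ c * (ω * (-(cos (φ t) - u₁ t))) := by
        gcongr
        linarith
      have hmin : δ ≤ c * (ω * (o * (9 / 100))) := min_le_right _ _
      linarith

lemma eventually_le_e (L : NormalizedLoop ω c k o α s t₀ e φ u₁ u₂ w) (hs : 65 / 100 ≤ s) :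
    ∀ᶠ t in atTop, -(435 / 1000 - 15 / 100 * o) ≤ e t := by
  have hω := L.hω
  have ho := L.ho
  have ho2 := L.ho2
  have hc := L.hc
  have hc0 : 0 < c := by linarith
  have hk := L.hk
  have hck : 0 < c * k := mul_pos hc0 hk
  have hg' := L.hgain'
  have hφM : ∀ t ≥ t₀, φ t ≤ π / 2 + 88 / 100 := by
    intro t ht
    by_contra! hlt
    have h1 := cos_le_cos_of_nonneg_of_le_pi (x := 88 / 100) (y := φ t - π / 2) (by norm_num)
      (by linarith [L.φ_lt t ht, pi_pos]) (by linarith)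
    rw [cos_sub_pi_div_two] at h1
    have h2 := abs_le.mp (Real.cos_bound (x := 88 / 100) (by norm_num [abs_of_pos]))
    rw [abs_of_pos (by norm_num)] at h2
    have h3 := L.hsin t ht
    norm_num at h2
    linarith [h2.2]
  set x₁ := 14 / 100 + 16 / 100 * o with hx₁
  let δ₁ := min (c * k * (x₁ * (1 - x₁)) + x₁ - (35 / 100 + o))
    (c * k * (1 / 4) + 1 / 2 - (35 / 100 + o))
  have hδ₁ : 0 < δ₁ := by
    refine lt_min ?_ ?_
    · have h1 : 0 < x₁ * (1 - x₁) := by nlinarith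
      have h2 : (2 + 4 * o) * (x₁ * (1 - x₁)) < c * k * (x₁ * (1 - x₁)) := by gcongr
      have h3 : 35 / 100 + o ≤ (2 + 4 * o) * (x₁ * (1 - x₁)) + x₁ := by
        rw [hx₁]
        nlinarith [mul_pos ho (sub_pos.mpr ho2), mul_pos ho (mul_pos ho (sub_pos.mpr ho2))]
      linarith
    · linarith
  let δ := min (ω * δ₁) (c * (ω * (o * (9 / 100))))
  have hδ : 0 < δ := lt_min (by positivity) (by positivity)
  have hbar := eventually_le_of_upperSlopeLE (T := t₀) (b := c * x₁ + (π / 2 + 88 / 100)) (δ := δ)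
    (f := fun t => max (φ t - c * e t) ((π / 2 - 6 / 5 * o) - c * e t)) hδ
    ((L.continuousOn_φ.sub (L.continuousOn_e.const_smul c)).sup
      (continuousOn_const.sub (L.continuousOn_e.const_smul c))) ?_
  · filter_upwards [hbar] with t ht
    have h1 := (le_max_right _ _).trans ht
    have h2 := lower_error_bound_le ho L.hoc ho2 hc
    refine (neg_le_neg h2).trans ?_
    rw [neg_le, ← hx₁, ← sub_le_iff_le_add', le_div_iff₀ hc0]
    linarith
  · intro t ht hb
    have hM := hφM t ht
    have hu₁ := abs_le.mp (L.hu₁ t ht)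
    have hu₂ := abs_le.mp (L.hu₂ t ht)
    have he := L.he t ht
    have hsin := L.hsin t ht
    have d1 := (L.dφ t ht).sub ((L.de t ht).const_mul c)
    have d2 := ((L.de t ht).const_mul c).const_sub (π / 2 - 6 / 5 * o)
    refine UpperSlopeLE.max d1.continuousAt d2.continuousAt (fun h => d1.upperSlopeLE.mono ?_)
      (fun h => d2.upperSlopeLE.mono ?_)
    · rw [max_eq_left h] at hb
      have hee : e t ≤ -x₁ := by
        by_contra! hlt
        nlinarith
      have hsat : sat (e t) = e t := sat_of_mem (by linarith) (by linarith)
      have hfrac : 1 + c * k * e t + δ₁ ≤ (sin (φ t) - u₂ t) / (1 + e t) := by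
        rw [le_div_iff₀ (by linarith)]
        obtain ⟨x, hx⟩ : ∃ x, x = -e t := ⟨_, rfl⟩
        have hxe : e t = -x := by linarith
        rw [hxe] at hee he ⊢
        have hconc : δ₁ ≤ c * k * (x * (1 - x)) + x - (35 / 100 + o) := by
          have hp : 0 ≤ (x - x₁) * (1 / 2 - x) := mul_nonneg (by linarith) (by linarith)
          have hq : x₁ * (1 - x₁) ≤ x * (1 - x) := by nlinarith
          have := min_le_left (c * k * (x₁ * (1 - x₁)) + x₁ - (35 / 100 + o))
            (c * k * (1 / 4) + 1 / 2 - (35 / 100 + o))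
          have hq' := mul_le_mul_of_nonneg_left hq hck.le
          simp only [δ₁]
          linarith
        nlinarith
      have : ω * δ₁ ≤ ω * (-(1 + c * k * e t - (sin (φ t) - u₂ t) / (1 + e t))) := by
        apply mul_le_mul_of_nonneg_left _ hω.le
        linarith
      have hmin : δ ≤ ω * δ₁ := min_le_left _ _
      rw [hsat]
      linarith
    · have hcos := L.le_cos_of_le ht (by linarith)
      have : c * (ω * (o * (9 / 100))) ≤ c * (ω * (cos (φ t) - u₁ t)) := by
        gcongr
        linarith
      have hmin : δ ≤ c * (ω * (o * (9 / 100))) := min_le_right _ _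
      linarith

lemma eventually_neg_cos_le (L : NormalizedLoop ω c k o α s t₀ e φ u₁ u₂ w) :
    ∀ᶠ t in atTop, -cos (φ t) ≤ 1 / (2 * k) := by
  have hω := L.hω
  have ho := L.ho
  have ho2 := L.ho2
  have hc := L.hc
  have hc0 : 0 < c := by linarith
  have hk := L.hk
  have hck : 0 < c * k := mul_pos hc0 hk
  have hs := L.hs
  have key := cos_barrier_poly ho ho2 hc L.hoc hk L.hgain
  obtain ⟨T, hT⟩ := eventually_atTop.mp (L.eventually_e_le.and (eventually_ge_atTop t₀))
  have hTt : ∀ t ≥ T, t₀ ≤ t := fun t ht => (hT t ht).2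
  set δ₁ := c * (1 / (2 * k)) - (1 + (c + 3) * o + k * (1571 / 1000 + 6 / 5 * o)) with hδ₁def
  have hδ₁ : 0 < δ₁ := sub_pos.mpr key
  refine eventually_le_of_upperSlopeLE (T := T) (δ := s * (ω * δ₁)) (by positivity)
    ((continuous_cos.comp_continuousOn (L.continuousOn_φ.mono fun t ht => hTt t ht)).neg) ?_
  intro t ht hb
  have ht₀ := hTt t ht
  have hu₁ := abs_le.mp (L.hu₁ t ht₀)
  have hu₂ := abs_le.mp (L.hu₂ t ht₀)
  have he := L.he t ht₀
  have hsin := L.hsin t ht₀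
  refine ((L.dφ t ht₀).cos.neg.upperSlopeLE).mono ?_
  have hsat : c * k * sat (e t) ≤ o + k * (1571 / 1000 + 6 / 5 * o) := by
    have h1 : sat (e t) ≤ o / (c * k + 1) + (1571 / 1000 + 6 / 5 * o) / c :=
      (sat_le_self (by linarith)).trans (hT t ht).1
    have h2 := mul_le_mul_of_nonneg_left h1 hck.le
    have h3 : c * k * (o / (c * k + 1)) ≤ o := by
      rw [mul_div_assoc', div_le_iff₀ (by linarith)]
      nlinarith
    have h4 : c * k * ((1571 / 1000 + 6 / 5 * o) / c) = k * (1571 / 1000 + 6 / 5 * o) := by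
      field_simp
    rw [mul_add, h4] at h2
    linarith
  have hfrac : -(2 * o) ≤ (sin (φ t) - u₂ t) / (1 + e t) := by
    rw [le_div_iff₀ (by linarith)]
    nlinarith
  have hcc : c * (1 / (2 * k)) ≤ c * (-cos (φ t)) := by gcongr
  have hcu : c * (-u₁ t) ≤ c * o := by
    gcongr
    linarith
  have hdot : δ₁ ≤ -(1 + c * (cos (φ t) - u₁ t + k * sat (e t))
      - (sin (φ t) - u₂ t) / (1 + e t)) := by
    rw [hδ₁def]
    linarith
  have : s * (ω * δ₁) ≤ sin (φ t) * (ω * -(1 + c * (cos (φ t) - u₁ t + k * sat (e t))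
      - (sin (φ t) - u₂ t) / (1 + e t))) := by
    gcongr
    exact hs.le.trans hsin
  linarith

lemma eventually_pos_bound (L : NormalizedLoop ω c k o α s t₀ e φ u₁ u₂ w) :
    ∀ᶠ t in atTop, sin (φ t) * ((sin (φ t) - u₂ t) / (1 + e t) - 1)
      + k * max 0 (cos (φ t) - u₁ t) ≤ (1 + 2 * o) * (sin (φ t) / s) := by
  have ho := L.ho
  have ho2 := L.ho2
  have hk := L.hk
  have hs := L.hs
  have hmax : ∀ t ≥ t₀, k * max 0 (cos (φ t) - u₁ t) ≤ k * (max 0 (cos (φ t)) + o) := by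
    intro t ht
    have hu₁ := abs_le.mp (L.hu₁ t ht)
    gcongr
    exact max_le (by positivity) (by linarith [le_max_right 0 (cos (φ t))])
  have hsq : ∀ t, sin (φ t) ^ 2 + (max 0 (cos (φ t))) ^ 2 ≤ 1 := by
    intro t
    have := sin_sq_add_cos_sq (φ t)
    rcases max_cases 0 (cos (φ t)) with h | h <;> rw [h.1] <;> nlinarith
  have hC : ∀ t, 0 ≤ max 0 (cos (φ t)) := fun t => le_max_left _ _
  rcases le_total s (65 / 100) with hs' | hs'
  · filter_upwards [eventually_ge_atTop t₀] with t ht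
    have hu₂ := abs_le.mp (L.hu₂ t ht)
    have he := L.he t ht
    have hsin := L.hsin t ht
    have hsin0 : 0 < sin (φ t) := hs.trans_le hsin
    have hfrac : (sin (φ t) - u₂ t) / (1 + e t) ≤ 2 * (sin (φ t) + o) := by
      rw [div_le_iff₀ (by linarith)]
      nlinarith
    have h1 : sin (φ t) * ((sin (φ t) - u₂ t) / (1 + e t) - 1)
        ≤ sin (φ t) * (2 * sin (φ t) + 2 * o - 1) := by
      gcongr
      linarith
    have h2 := hmax t ht
    rcases le_total (sin (φ t)) (65 / 100) with h | h
    · have h3 := sin_sector_bound_of_le hsin0 h (hsq t) (hC t) ho ho2 L.k_le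
      have h4 : 1 ≤ sin (φ t) / s := (one_le_div hs).mpr hsin
      nlinarith
    · have h3 := sin_sector_bound_of_ge h (hsq t) (hC t) ho ho2 L.k_le
      have h4 : (1 + 2 * o) * (sin (φ t) / (65 / 100)) ≤ (1 + 2 * o) * (sin (φ t) / s) := by
        gcongr
      linarith
  · filter_upwards [eventually_ge_atTop t₀, L.eventually_le_e hs'] with t ht hel
    have hu₂ := abs_le.mp (L.hu₂ t ht)
    have hsin := L.hsin t ht
    have hsin0 : 0 < sin (φ t) := hs.trans_le hsin
    have hden : 0 < 565 / 1000 + 15 / 100 * o := by positivity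
    have hfrac : (sin (φ t) - u₂ t) / (1 + e t)
        ≤ (sin (φ t) + o) / (565 / 1000 + 15 / 100 * o) := by
      apply div_le_div₀ <;> linarith
    have h1 := sin_mul_sin_add_le (hs'.trans hsin) (hsq t) (hC t) ho ho2 L.k_le
    rw [← div_le_iff₀' hden, mul_div_assoc] at h1
    have h2 := mul_le_mul_of_nonneg_left hfrac hsin0.le
    have h3 := hmax t ht
    have h4 : 1 ≤ sin (φ t) / s := (one_le_div hs).mpr hsin
    nlinarith

lemma eventually_neg_bound (L : NormalizedLoop ω c k o α s t₀ e φ u₁ u₂ w) :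
    ∀ᶠ t in atTop, sin (φ t) * (1 - (sin (φ t) - u₂ t) / (1 + e t))
      + k * max 0 (-(cos (φ t) - u₁ t)) ≤ (1 + 2 * o) * (sin (φ t) / s) := by
  have ho := L.ho
  have ho2 := L.ho2
  have hk := L.hk
  have hs := L.hs
  have hc := L.hc
  have hc0 : 0 < c := by linarith
  have hE : o / (c * k + 1) + (1571 / 1000 + 6 / 5 * o) / c ≤ 1 := by
    have h1 : o / (c * k + 1) ≤ 1 / 6 := by
      rw [div_le_iff₀ (by positivity)]
      nlinarith [L.hgain']
    have h2 : (1571 / 1000 + 6 / 5 * o) / c ≤ 5 / 6 := by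
      rw [div_le_iff₀ hc0]
      linarith
    linarith
  filter_upwards [eventually_ge_atTop t₀, L.eventually_e_le, L.eventually_neg_cos_le]
    with t ht he1 hcos
  have hu₁ := abs_le.mp (L.hu₁ t ht)
  have hu₂ := abs_le.mp (L.hu₂ t ht)
  have he := L.he t ht
  have hsin := L.hsin t ht
  have hsin0 : 0 < sin (φ t) := hs.trans_le hsin
  have hD : k * max 0 (-cos (φ t)) ≤ 1 / 2 := by
    have : max 0 (-cos (φ t)) ≤ 1 / (2 * k) := max_le (by positivity) hcos
    calc _ ≤ k * (1 / (2 * k)) := by gcongr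
      _ = 1 / 2 := by field_simp
  have h1 := sin_sector_bound_neg hsin0 (sin_le_one _) he (he1.trans hE) ho ho2
    (by linarith [L.k_le]) hD
  have hmax : k * max 0 (-(cos (φ t) - u₁ t)) ≤ k * (max 0 (-cos (φ t)) + o) := by
    gcongr
    exact max_le (by positivity) (by linarith [le_max_right 0 (-cos (φ t))])
  have hfrac : (sin (φ t) - o) / (1 + e t) ≤ (sin (φ t) - u₂ t) / (1 + e t) := by
    apply div_le_div_of_nonneg_right <;> linarith
  have h2 := mul_le_mul_of_nonneg_left hfrac hsin0.le
  have h4 : 1 ≤ sin (φ t) / s := (one_le_div hs).mpr hsin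
  nlinarith

theorem eventually_abs_sliding_le (L : NormalizedLoop ω c k o α s t₀ e φ u₁ u₂ w) {ε : ℝ}
    (hε : 0 < ε) : ∀ᶠ t in atTop,
      |cos (φ t) - u₁ t + k * sat (e t)| ≤ (1 + 2 * o + α) / (c * s) + ε := by
  have hω := L.hω
  have hc := L.hc
  have hc0 : 0 < c := by linarith
  have hk := L.hk
  have hs := L.hs
  set B := (1 + 2 * o + α) / (c * s) + ε with hB
  have hcB : ∀ t ≥ t₀, ∀ ζ, B ≤ ζ →
      (1 + 2 * o) * (sin (φ t) / s) + α + s * (c * ε) ≤ sin (φ t) * (c * ζ) := by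
    intro t ht ζ hζ
    have hsin := L.hsin t ht
    have hsin0 : 0 < sin (φ t) := hs.trans_le hsin
    have h1 : sin (φ t) * (c * B) ≤ sin (φ t) * (c * ζ) := by gcongr
    have h2 : sin (φ t) * (c * B)
        = (1 + 2 * o) * (sin (φ t) / s) + α * (sin (φ t) / s) + sin (φ t) * (c * ε) := by
      rw [hB]
      field_simp
    have h3 : α * 1 ≤ α * (sin (φ t) / s) :=
      mul_le_mul_of_nonneg_left ((one_le_div hs).mpr hsin) L.hα
    have h4 : s * (c * ε) ≤ sin (φ t) * (c * ε) := by gcongr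
    linarith
  have hδ : 0 < ω * (s * (c * ε)) := by positivity
  have hcont : ContinuousOn (fun t => cos (φ t) - u₁ t + k * sat (e t)) (Ici t₀) :=
    ((continuous_cos.comp_continuousOn L.continuousOn_φ).sub L.continuousOn_u₁).add
      ((continuous_sat.comp_continuousOn L.continuousOn_e).const_smul k)
  obtain ⟨T, hT⟩ := eventually_atTop.mp
    ((L.eventually_pos_bound.and L.eventually_neg_bound).and (eventually_ge_atTop t₀))
  have hpos := eventually_le_of_upperSlopeLE (T := T) (b := B)
    (f := fun t => (cos (φ t) - u₁ t) + k * sat (e t)) hδ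
    (hcont.mono fun t ht => (hT t ht).2) fun t ht hb => by
      have ht₀ := (hT t ht).2
      have hP := (hT t ht).1.1
      have hw := abs_le.mp (L.hw t ht₀)
      have hζ := hcB t ht₀ _ hb
      have hP' := mul_le_mul_of_nonneg_left hP hω.le
      have hζ' := mul_le_mul_of_nonneg_left hζ hω.le
      refine (((L.dφ t ht₀).cos.sub (L.du t ht₀)).upperSlopeLE.add
        ((L.de t ht₀).upperSlopeLE_sat.const_mul hk)).mono ?_
      have hm : max 0 (ω * (cos (φ t) - u₁ t)) = ω * max 0 (cos (φ t) - u₁ t) := by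
        rw [mul_max_of_nonneg _ _ hω.le, mul_zero]
      rw [hm]
      linarith
  have hneg := eventually_le_of_upperSlopeLE (T := T) (b := B)
    (f := fun t => -(cos (φ t) - u₁ t) + k * -sat (e t)) hδ
    ((hcont.mono fun t ht => (hT t ht).2).neg.congr fun t _ => by simp only [Pi.neg_apply]; ring)
    fun t ht hb => by
      have ht₀ := (hT t ht).2
      have hN := (hT t ht).1.2
      have hw := abs_le.mp (L.hw t ht₀)
      have hζ := hcB t ht₀ _ hb
      have hN' := mul_le_mul_of_nonneg_left hN hω.le
      have hζ' := mul_le_mul_of_nonneg_left hζ hω.le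
      refine (((L.dφ t ht₀).cos.sub (L.du t ht₀)).neg.upperSlopeLE.add
        ((L.de t ht₀).upperSlopeLE_neg_sat.const_mul hk)).mono ?_
      have hm : max 0 (-(ω * (cos (φ t) - u₁ t))) = ω * max 0 (-(cos (φ t) - u₁ t)) := by
        rw [mul_max_of_nonneg _ _ hω.le, mul_zero, mul_neg]
      rw [hm]
      linarith
  filter_upwards [hpos, hneg] with t h1 h2
  exact abs_le.mpr ⟨by linarith, h1⟩

end NormalizedLoop

/-- A continuous angle with positive sine stays in one interval `(2πn, 2πn + π)`. -/
lemma exists_shift_mem_Ioo_of_sin_pos {φ : ℝ → ℝ} {t₀ : ℝ} (hφ : Continuous φ)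
    (h : ∀ t ≥ t₀, 0 < sin (φ t)) :
    ∃ n : ℤ, ∀ t ≥ t₀, φ t - n * (2 * π) ∈ Ioo 0 π := by
  set n := ⌊φ t₀ / (2 * π)⌋
  have h2π : 0 < 2 * π := by positivity
  have hsin : ∀ t ≥ t₀, 0 < sin (φ t - n * (2 * π)) := fun t ht => by
    rw [sin_sub_int_mul_two_pi]
    exact h t ht
  have hl : n * (2 * π) ≤ φ t₀ := (le_div_iff₀ h2π).mp (Int.floor_le _)
  have hr : φ t₀ < (n + 1) * (2 * π) := (div_lt_iff₀ h2π).mp (Int.lt_floor_add_one _)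
  have hs₀ := hsin t₀ le_rfl
  have h0 : 0 < φ t₀ - n * (2 * π) := by
    refine lt_of_le_of_ne (by linarith) fun hEq => ?_
    rw [← hEq, sin_zero] at hs₀
    exact lt_irrefl _ hs₀
  have h1 : φ t₀ - n * (2 * π) < π := by
    by_contra! hge
    have := sin_nonpos_of_nonpos_of_neg_pi_le (x := φ t₀ - n * (2 * π) - 2 * π)
      (by linarith) (by linarith)
    rw [sin_sub_two_pi] at this
    linarith
  refine ⟨n, fun t ht => ?_⟩
  have hcont : ContinuousOn (fun t => φ t - n * (2 * π)) (uIcc t₀ t) := by fun_prop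
  have hivt := intermediate_value_uIcc hcont
  have hno : ∀ x, sin x = 0 → x ∉ uIcc (φ t₀ - n * (2 * π)) (φ t - n * (2 * π)) := by
    intro x hx hmem
    obtain ⟨y, hy, hyx⟩ := hivt hmem
    rw [uIcc_of_le ht] at hy
    have := hsin y hy.1
    simp only at hyx
    rw [hyx, hx] at this
    exact lt_irrefl _ this
  constructor
  · by_contra! hle
    exact hno 0 sin_zero (mem_uIcc.mpr (Or.inr ⟨hle, h0.le⟩))
  · by_contra! hle
    exact hno π sin_pi (mem_uIcc.mpr (Or.inl ⟨h1.le, hle⟩))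

end

/-- Step 2 of the proof of Proposition 2: uniform ultimate bound on the sliding
variable `z(t) = e'(t) + (c2/c1)·sat(e(t))`, where `e(t) = (d(t) − r_d)/r_d`,
assuming `d(t) > r_d/2` and `sin φ(t) ≥ s*` for all `t ≥ t0`. -/
theorem step2_sliding_variable_ultimate_bound
    (t0 v rd c1 c2 vbar abar ωc ωo : ℝ)
    (hv : 0 < v) (hrd : 0 < rd) (hc1 : 0 < c1) (hc2 : 0 < c2)
    (hvbar : 0 < vbar) (habar : 0 < abar) (hvo : vbar < v)
    (hωc : ωc = v / rd) (hωo : ωo = vbar / rd)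
    (hgain1 : (c1 - 1) * ωc > c2 + (c1 + 1) * ωo)
    (hgain2 : c2 > max ((c1 + 1) * ωo) (2 * ωc + 4 * ωo))
    (d φ v1 v2 : ℝ → ℝ)
    (hd : Differentiable ℝ d) (hφ : Differentiable ℝ φ)
    (hv1 : Differentiable ℝ v1) (hv2 : Differentiable ℝ v2)
    (hdpos : ∀ t ≥ t0, 0 < d t)
    (hvel : ∀ t ≥ t0, v1 t ^ 2 + v2 t ^ 2 ≤ vbar ^ 2)
    (hacc : ∀ t ≥ t0, |deriv v1 t| ≤ abar)
    (hddot : ∀ t ≥ t0, deriv d t = v * Real.cos (φ t) - v1 t)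
    (hφdot : ∀ t ≥ t0, deriv φ t =
      ωc + (c1 / rd) * deriv d t + c2 * sat ((d t - rd) / rd)
        - (v / d t) * Real.sin (φ t) + v2 t / d t)
    (sstar : ℝ) (hsstar0 : 0 < sstar) (hsstar1 : sstar ≤ 1)
    (hsector : ∀ t ≥ t0, d t > rd / 2 ∧ Real.sin (φ t) ≥ sstar) :
    Filter.limsup
      (fun t => |deriv (fun s => (d s - rd) / rd) t
                  + (c2 / c1) * sat ((d t - rd) / rd)|) Filter.atTop ≤
      (ωc * (ωc + 2 * ωo) + abar / rd + (c2 / c1) * (v + vbar)) / (c1 * ωc * sstar) := by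
  obtain ⟨hgain3, hgain4⟩ := max_lt_iff.mp hgain2
  have hω : 0 < ωc := hωc ▸ div_pos hv hrd
  have hωo' : ωo = ωc * (vbar / v) := by rw [hωo, hωc]; field_simp
  have ho : 0 < vbar / v := by positivity
  have hv_eq : v = ωc * rd := by rw [hωc]; field_simp
  have hck : c1 * (c2 / (c1 * ωc)) = c2 / ωc := by field_simp
  have hc : 3 < c1 := by
    have : 0 < ωo := by rw [hωo]; positivity
    nlinarith
  obtain ⟨n, hn⟩ := exists_shift_mem_Ioo_of_sin_pos hφ.continuous
    fun t ht => hsstar0.trans_le (hsector t ht).2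
  have hde : ∀ t ≥ t0, HasDerivAt (fun s => (d s - rd) / rd)
      (ωc * (Real.cos (φ t) - v1 t / v)) t := by
    intro t ht
    refine (((hd t).hasDerivAt.sub_const rd).div_const rd).congr_deriv ?_
    rw [hddot t ht, hωc]
    field_simp
  have hvel1 : ∀ t ≥ t0, |v1 t / v| ≤ vbar / v := fun t ht => by
    rw [abs_div, abs_of_pos hv]
    gcongr
    exact abs_le_of_sq_le_sq (by nlinarith [hvel t ht, sq_nonneg (v2 t)]) hvbar.le
  have hvel2 : ∀ t ≥ t0, |v2 t / v| ≤ vbar / v := fun t ht => by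
    rw [abs_div, abs_of_pos hv]
    gcongr
    exact abs_le_of_sq_le_sq (by nlinarith [hvel t ht, sq_nonneg (v1 t)]) hvbar.le
  have L : NormalizedLoop ωc c1 (c2 / (c1 * ωc)) (vbar / v) (abar / (v * ωc)) sstar t0
      (fun t => (d t - rd) / rd) (fun t => φ t - n * (2 * π)) (fun t => v1 t / v)
      (fun t => v2 t / v) (fun t => deriv v1 t / v) :=
    { hω := hω
      ho := ho
      ho2 := by
        rw [hωo'] at hgain1 hgain3
        by_contra! h
        have : (c1 + 1) * ωc * (1 / 2) ≤ (c1 + 1) * ωc * (vbar / v) := by gcongr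
        nlinarith
      hc := hc
      hk := by positivity
      hgain := by
        rw [hck, div_lt_iff₀ hω]
        rw [hωo'] at hgain1
        linarith
      hgain' := by
        rw [hck, lt_div_iff₀ hω]
        rw [hωo'] at hgain4
        linarith
      hs := hsstar0
      hα := by positivity
      de := fun t ht => by
        rw [Real.cos_sub_int_mul_two_pi]
        exact hde t ht
      dφ := fun t ht => by
        refine ((hφ t).hasDerivAt.sub_const (n * (2 * π))).congr_deriv ?_
        have hdt := (hdpos t ht).ne'
        have h1 : 1 + (d t - rd) / rd = d t / rd := by field_simp; ring
        rw [Real.cos_sub_int_mul_two_pi, Real.sin_sub_int_mul_two_pi, hφdot t ht, hddot t ht, h1,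
          hv_eq]
        field_simp
        ring
      du := fun t ht => (hv1 t).hasDerivAt.div_const v
      hw := fun t ht => by
        rw [abs_div, abs_of_pos hv]
        calc |deriv v1 t| / v ≤ abar / v := by gcongr; exact hacc t ht
          _ = ωc * (abar / (v * ωc)) := by field_simp
      hu₁ := hvel1
      hu₂ := hvel2
      he := fun t ht => by
        rw [lt_div_iff₀ hrd]
        linarith [(hsector t ht).1]
      hsin := fun t ht => by
        rw [Real.sin_sub_int_mul_two_pi]
        exact (hsector t ht).2
      φ_pos := fun t ht => (hn t ht).1
      φ_lt := fun t ht => (hn t ht).2 }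
  refine le_of_forall_pos_le_add fun ε hε => ?_
  refine limsup_le_of_le (isCoboundedUnder_le_of_le atTop fun t => abs_nonneg _) ?_
  filter_upwards [L.eventually_abs_sliding_le (div_pos hε hω), eventually_ge_atTop t0]
    with t ht ht0
  rw [Real.cos_sub_int_mul_two_pi] at ht
  have hz : deriv (fun s => (d s - rd) / rd) t + c2 / c1 * sat ((d t - rd) / rd)
      = ωc * (Real.cos (φ t) - v1 t / v + c2 / (c1 * ωc) * sat ((d t - rd) / rd)) := by
    rw [(hde t ht0).deriv]
    field_simp
  have hnn : 0 ≤ c2 / c1 * (v + vbar) / (c1 * ωc * sstar) := by positivity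
  rw [hz, abs_mul, abs_of_pos hω]
  calc _ ≤ ωc * ((1 + 2 * (vbar / v) + abar / (v * ωc)) / (c1 * sstar) + ε / ωc) := by gcongr
    _ = (ωc * (ωc + 2 * ωo) + abar / rd) / (c1 * ωc * sstar) + ε := by
        rw [hωo', hv_eq]
        field_simp
    _ ≤ _ := by
        rw [add_div _ (c2 / c1 * (v + vbar))]
        linarith
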